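/- There exists a valuation v ∈ Val(M_{IL_p}) with v(¬¬(p ∨ ¬p)) = F for an atom p; hence the unrestricted Nmatrix M_{IL_p} fails to validate the intuitionistic tautology ¬¬(p ∨ ¬p), i.e., M_{IL_p} without the restriction is weaker than intuitionistic propositional logic. -/

import Mathlib

/-- Formulas of intuitionistic propositional logic. -/
inductive IForm : Type where
  | atom : ℕ → IForm
  | bot : IForm
  | top : IForm
  | neg : IForm → IForm
  | imp : IForm → IForm → IForm
  | conj : IForm → IForm → IForm
  | disj : IForm → IForm → IForm
deriving DecidableEq

/-- Multifunction for negation in `M_{ILp}`: `¬̃F = {F, T}`, `¬̃T = {F}`.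
(`true` is the value `T`, `false` is `F`.) -/
def INeg : Bool → Set Bool
  | false => Set.univ
  | true => {false}

/-- Multifunction for implication in `M_{ILp}`. -/
def IImp : Bool → Bool → Set Bool
  | false, false => Set.univ
  | false, true => {true}
  | true, false => {false}
  | true, true => {true}

/-- `v ∈ Val(M_{ILp})`. -/
def IIsVal (v : IForm → Bool) : Prop :=
  v IForm.bot = false ∧ v IForm.top = true ∧
  (∀ a, v (IForm.neg a) ∈ INeg (v a)) ∧
  (∀ a b, v (IForm.imp a b) ∈ IImp (v a) (v b)) ∧
  (∀ a b, v (IForm.conj a b) = (v a && v b)) ∧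
  (∀ a b, v (IForm.disj a b) = (v a || v b))

/-- The levels `L_k` of valuations of `M_{ILp}`. -/
def ILev : ℕ → Set (IForm → Bool)
  | 0 => {v | IIsVal v}
  | k + 1 => {v | v ∈ ILev k ∧
      (∀ a b, v a = false → v b = false → v (IForm.imp a b) = false →
        ∃ w ∈ ILev k, w a = true ∧ w b = false ∧ ∀ c, v c = true → w c = true) ∧
      (∀ a, v a = false → v (IForm.neg a) = false →
        ∃ w ∈ ILev k, w a = true ∧ ∀ c, v c = true → w c = true)}

/-- `L^{ILp} = ⋂_k L_k`, the restricted set of valuations of the RNmatrix for `ILp`. -/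
def ILimit : Set (IForm → Bool) := {v | ∀ k, v ∈ ILev k}

/-- The valuation that sends every atom and every negation to `F` and is classical on the other
connectives. -/
def negFalseVal : IForm → Bool
  | .atom _ => false
  | .bot => false
  | .top => true
  | .neg _ => false
  | .imp a b => !negFalseVal a || negFalseVal b
  | .conj a b => negFalseVal a && negFalseVal b
  | .disj a b => negFalseVal a || negFalseVal b

theorem negFalseVal_isVal : IIsVal negFalseVal := by
  refine ⟨rfl, rfl, fun a => ?_, fun a b => ?_, fun _ _ => rfl, fun _ _ => rfl⟩
  · cases h : negFalseVal a <;> simp [INeg, negFalseVal]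
  · cases ha : negFalseVal a <;> cases hb : negFalseVal b <;> simp [IImp, negFalseVal, ha, hb]

theorem unrestricted_MILp_fails_double_negated_excluded_middle (p : ℕ) :
    ∃ v : IForm → Bool, IIsVal v ∧
      v (IForm.neg (IForm.neg (IForm.disj (IForm.atom p)
          (IForm.neg (IForm.atom p))))) = false :=
  ⟨negFalseVal, negFalseVal_isVal, rfl⟩
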